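/- arXiv:1504.06683 — 2 statements merged into one kernel-verified Lean document; each statement's English description precedes it below -/
import Mathlib

section
/- Fix y ∈ 𝓨. If {x ∈ 𝓝^∞ : El(x,y) < +∞} ⊆ acl(dom₁Ef ∩ 𝓝^∞), where acl C (the algebraic closure of a convex set C) is the set of points x for which {(1−λ)x+λz : λ ∈ (0,1]} ⊆ C for some z ∈ C, then φ̃*(y) = −inf_{x∈𝓝^∞} El(x,y). -/
open MeasureTheory
open scoped ENNReal

noncomputable section

/-- The positive part of an extended real number, as an extended nonnegative real. -/
def epos (a : EReal) : ℝ≥0∞ := if a = ⊤ then ⊤ else ENNReal.ofReal a.toReal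

/-- Expectation of an extended-real-valued function: it equals `+∞` unless the positive
part is integrable, in which case it is the usual (possibly `-∞`) integral. -/
def EE {Ω : Type} [MeasurableSpace Ω] (P : Measure Ω) (φ : Ω → EReal) : EReal :=
  if ∫⁻ ω, epos (φ ω) ∂P = ⊤ then ⊤
  else ((∫⁻ ω, epos (φ ω) ∂P : ℝ≥0∞) : EReal) - ((∫⁻ ω, epos (-(φ ω)) ∂P : ℝ≥0∞) : EReal)

/-- `ℝ^n` viewed as `ℝ^{n_0} × ⋯ × ℝ^{n_T}`. -/
abbrev Vec {T : ℕ} (nt : Fin (T+1) → ℕ) : Type := (t : Fin (T+1)) → Fin (nt t) → ℝ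

/-- `x·v = Σ_t x_t·v_t`. -/
def dotN {T : ℕ} (nt : Fin (T+1) → ℕ) (a b : Vec nt) : ℝ := ∑ t, ∑ i, a t i * b t i

/-- The scalar product on `ℝ^m`. -/
def dotM {m : ℕ} (a b : Fin m → ℝ) : ℝ := ∑ j, a j * b j

variable {Ω : Type} [MeasurableSpace Ω] {T : ℕ} {nt : Fin (T+1) → ℕ} {m : ℕ}

/-- The space `𝓝` of adapted strategies. -/
def Nspace (nt : Fin (T+1) → ℕ) (ℱ : Fin (T+1) → MeasurableSpace Ω) :
    Set (Ω → Vec nt) := {x | ∀ t, Measurable[ℱ t] (fun ω => x ω t)}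

/-- The space `𝓝^∞` of essentially bounded adapted strategies. -/
def NspaceInf (nt : Fin (T+1) → ℕ) (ℱ : Fin (T+1) → MeasurableSpace Ω)
    (P : Measure Ω) : Set (Ω → Vec nt) :=
  {x | x ∈ Nspace nt ℱ ∧ ∃ M : ℝ, ∀ᵐ ω ∂P, ‖x ω‖ ≤ M}

/-- The annihilator `𝓝^⊥` of `𝓝^∞` in `L¹`. -/
def Nperp (nt : Fin (T+1) → ℕ) (ℱ : Fin (T+1) → MeasurableSpace Ω)
    (P : Measure Ω) : Set (Ω → Vec nt) :=
  {v | Measurable v ∧ Integrable v P ∧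
    ∀ x ∈ NspaceInf nt ℱ P, ∫ ω, dotN nt (x ω) (v ω) ∂P = 0}

/-- `Ef(x,u)`. -/
def intF (P : Measure Ω) (f : Vec nt → (Fin m → ℝ) → Ω → EReal)
    (x : Ω → Vec nt) (u : Ω → Fin m → ℝ) : EReal :=
  EE P (fun ω => f (x ω) (u ω) ω)

/-- The bilinear pairing `⟨u,y⟩ = E(u·y)`. -/
def pairing (P : Measure Ω) (u y : Ω → Fin m → ℝ) : ℝ := ∫ ω, dotM (u ω) (y ω) ∂P

/-- The value function `φ(u) = inf_{x∈𝓝} Ef(x,u)`. -/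
def valueFn (P : Measure Ω) (f : Vec nt → (Fin m → ℝ) → Ω → EReal)
    (ℱ : Fin (T+1) → MeasurableSpace Ω) (u : Ω → Fin m → ℝ) : EReal :=
  ⨅ x ∈ Nspace nt ℱ, intF P f x u

/-- The auxiliary value function `φ̃(u) = inf_{x∈𝓝^∞} Ef(x,u)`. -/
def valueFnInf (P : Measure Ω) (f : Vec nt → (Fin m → ℝ) → Ω → EReal)
    (ℱ : Fin (T+1) → MeasurableSpace Ω) (u : Ω → Fin m → ℝ) : EReal :=
  ⨅ x ∈ NspaceInf nt ℱ P, intF P f x u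

/-- The conjugate on `𝓨` of a function `g` on `𝓤`. -/
def conj (P : Measure Ω) (𝓤 : Set (Ω → Fin m → ℝ)) (g : (Ω → Fin m → ℝ) → EReal)
    (y : Ω → Fin m → ℝ) : EReal :=
  ⨆ u ∈ 𝓤, (((pairing P u y : ℝ) : EReal) - g u)

/-- The Lagrangian integrand `l(x,y,ω) = inf_u {f(x,u,ω) − u·y}`. -/
def lagr (f : Vec nt → (Fin m → ℝ) → Ω → EReal) (x : Vec nt) (y : Fin m → ℝ)
    (ω : Ω) : EReal :=
  ⨅ u : Fin m → ℝ, (f x u ω - ((dotM u y : ℝ) : EReal))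

/-- `El(x,y)`. -/
def intL (P : Measure Ω) (f : Vec nt → (Fin m → ℝ) → Ω → EReal)
    (x : Ω → Vec nt) (y : Ω → Fin m → ℝ) : EReal :=
  EE P (fun ω => lagr f (x ω) (y ω) ω)

/-- The pointwise conjugate `f*(v,y,ω)`. -/
def fconj (f : Vec nt → (Fin m → ℝ) → Ω → EReal) (v : Vec nt) (y : Fin m → ℝ)
    (ω : Ω) : EReal :=
  ⨆ x : Vec nt, ⨆ u : Fin m → ℝ, (((dotN nt x v + dotM u y : ℝ) : EReal) - f x u ω)

/-- `Ef*(v,y)`. -/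
def intFconj (P : Measure Ω) (f : Vec nt → (Fin m → ℝ) → Ω → EReal)
    (v : Ω → Vec nt) (y : Ω → Fin m → ℝ) : EReal :=
  EE P (fun ω => fconj f (v ω) (y ω) ω)

/-- `l̲(x,y,ω) = sup_v {x·v − f*(v,y,ω)}`. -/
def lagrLow (f : Vec nt → (Fin m → ℝ) → Ω → EReal) (x : Vec nt) (y : Fin m → ℝ)
    (ω : Ω) : EReal :=
  ⨆ v : Vec nt, (((dotN nt x v : ℝ) : EReal) - fconj f v y ω)

/-- `El̲(x,y)`. -/
def intLlow (P : Measure Ω) (f : Vec nt → (Fin m → ℝ) → Ω → EReal)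
    (x : Ω → Vec nt) (y : Ω → Fin m → ℝ) : EReal :=
  EE P (fun ω => lagrLow f (x ω) (y ω) ω)

/-- `dom₁ Ef = {x ∈ 𝓝 : Ef(x,u) < +∞ for some u ∈ 𝓤}`. -/
def dom1intF (P : Measure Ω) (f : Vec nt → (Fin m → ℝ) → Ω → EReal)
    (ℱ : Fin (T+1) → MeasurableSpace Ω) (𝓤 : Set (Ω → Fin m → ℝ)) :
    Set (Ω → Vec nt) :=
  {x | x ∈ Nspace nt ℱ ∧ ∃ u ∈ 𝓤, intF P f x u < ⊤}

/-- The algebraic closure of a convex set in a real vector space. -/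
def acl {A : Type} [AddCommGroup A] [Module ℝ A] (C : Set A) : Set A :=
  {x | ∃ z ∈ C, ∀ lam : ℝ, 0 < lam → lam ≤ 1 → ((1 - lam) • x + lam • z) ∈ C}

/-- Decomposability of a set of measurable functions. -/
def Decomposable (P : Measure Ω) (𝓤 : Set (Ω → Fin m → ℝ)) : Prop :=
  ∀ A : Set Ω, MeasurableSet A → ∀ u ∈ 𝓤, ∀ u' : Ω → Fin m → ℝ,
    Measurable u' → (∃ M : ℝ, ∀ᵐ ω ∂P, ‖u' ω‖ ≤ M) →
    (fun ω => A.indicator u ω + Aᶜ.indicator u' ω) ∈ 𝓤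

end


open Set Filter Topology in
theorem aux_open (k : ℕ → ℕ) (W : Set (ℕ → ℕ)) (hW : IsOpen W)
    (hK : {σ : ℕ → ℕ | ∀ i, σ i ≤ k i} ⊆ W) :
    ∃ n, {σ : ℕ → ℕ | ∀ i < n, σ i ≤ k i} ⊆ W := by
  by_contra hcon
  push Not at hcon
  have h1 : ∀ n, ∃ σ : ℕ → ℕ, (∀ i < n, σ i ≤ k i) ∧ σ ∉ W := by
    intro n
    obtain ⟨σ, h, h'⟩ := Set.not_subset.1 (hcon n)
    exact ⟨σ, h, h'⟩
  choose s hs hsW using h1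
  have hcomp : IsCompact {σ : ℕ → ℕ | ∀ i, σ i ≤ k i} := by
    have : {σ : ℕ → ℕ | ∀ i, σ i ≤ k i} = Set.pi univ (fun i => Set.Iic (k i)) := by
      ext σ; simp [Pi.le_def]
    rw [this]
    exact isCompact_univ_pi fun i => (Set.finite_Iic (k i)).isCompact
  obtain ⟨t, ht, φ, hφ, hlim⟩ := hcomp.tendsto_subseq
    (x := fun n i => min (s n i) (k i)) (fun n i => min_le_right _ _)
  have hlim2 : Tendsto (s ∘ φ) atTop (𝓝 t) := by
    rw [tendsto_pi_nhds] at hlim ⊢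
    intro i
    refine (hlim i).congr' ?_
    filter_upwards [eventually_gt_atTop i] with n hn
    exact min_eq_left (hs (φ n) i (lt_of_lt_of_le hn (hφ.id_le n)))
  obtain ⟨n, hn⟩ := (hlim2.eventually (hW.mem_nhds (hK ht))).exists
  exact hsW _ hn

open Set Filter Topology in
theorem aux_inner {X : Type*} [TopologicalSpace X] [T2Space X] [MeasurableSpace X]
    [OpensMeasurableSpace X] (μ : Measure X) [IsFiniteMeasure μ] (g : (ℕ → ℕ) → X)
    (hg : Continuous g) (c : ℝ≥0∞) (hc : c < μ (range g)) :
    ∃ C, C ⊆ range g ∧ MeasurableSet C ∧ c ≤ μ C := by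
  have step : ∀ (n : ℕ) (S : Set (ℕ → ℕ)), c < μ (g '' S) →
      ∃ k : ℕ, c < μ (g '' (S ∩ {σ | σ n ≤ k})) := by
    intro n S hS
    have h1 : g '' S = ⋃ k : ℕ, g '' (S ∩ {σ | σ n ≤ k}) := by
      rw [← image_iUnion, ← inter_iUnion]
      congr 1
      ext σ
      simp only [mem_inter_iff, mem_iUnion, mem_ofPred_eq]
      exact ⟨fun h => ⟨h, _, le_rfl⟩, fun h => h.1⟩
    have hm : Monotone fun k : ℕ => g '' (S ∩ {σ | σ n ≤ k}) := by
      intro a b hab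
      apply image_mono
      apply inter_subset_inter_right
      intro σ hσ
      exact le_trans hσ hab
    rw [h1, hm.measure_iUnion, lt_iSup_iff] at hS
    exact hS
  choose k hk using step
  let S : ℕ → {S : Set (ℕ → ℕ) // c < μ (g '' S)} := fun n =>
    Nat.rec ⟨univ, by simpa using hc⟩
      (fun n S => ⟨S.1 ∩ {σ | σ n ≤ k n S.1 S.2}, hk n S.1 S.2⟩) n
  let kk : ℕ → ℕ := fun n => k n (S n).1 (S n).2
  have hS : ∀ n, (S n).1 = {σ : ℕ → ℕ | ∀ i < n, σ i ≤ kk i} := by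
    intro n
    induction n with
    | zero => ext σ; simp [S]
    | succ n ih =>
      have : (S (n+1)).1 = (S n).1 ∩ {σ | σ n ≤ kk n} := rfl
      rw [this, ih]
      ext σ
      simp only [mem_inter_iff, mem_ofPred_eq, Nat.forall_lt_succ_right]
  have hcomp : IsCompact {σ : ℕ → ℕ | ∀ i, σ i ≤ kk i} := by
    have : {σ : ℕ → ℕ | ∀ i, σ i ≤ kk i} = Set.pi univ (fun i => Set.Iic (kk i)) := by
      ext σ; simp [Pi.le_def]
    rw [this]
    exact isCompact_univ_pi fun i => (Set.finite_Iic (kk i)).isCompact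
  have hgc := hcomp.image hg
  refine ⟨_, image_subset_range g _, hgc.isClosed.measurableSet, ?_⟩
  have hsub : (⋂ n, closure (g '' (S n).1)) ⊆ g '' {σ : ℕ → ℕ | ∀ i, σ i ≤ kk i} := by
    intro p hp
    by_contra hpn
    obtain ⟨U, V, hU, hV, hKU, hpV, hUV⟩ :=
      SeparatedNhds.of_isCompact_isCompact hgc (isCompact_singleton (x := p))
        (disjoint_singleton_right.2 hpn)
    obtain ⟨n, hn⟩ := aux_open kk (g ⁻¹' U) (hU.preimage hg) (image_subset_iff.1 hKU)
    rw [← hS n, ← image_subset_iff] at hn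
    have := mem_iInter.1 hp n
    rw [mem_closure_iff] at this
    obtain ⟨q, hqV, hq⟩ := this V hV (hpV rfl)
    exact (hUV.le_bot ⟨hn hq, hqV⟩ : q ∈ (∅ : Set X))
  refine le_trans ?_ (measure_mono hsub)
  have hanti : Antitone fun n => closure (g '' (S n).1) := by
    intro a b hab
    apply closure_mono
    apply image_mono
    rw [hS, hS]
    intro σ hσ i hi
    exact hσ i (lt_of_lt_of_le hi hab)
  rw [hanti.measure_iInter (fun n => isClosed_closure.measurableSet.nullMeasurableSet)
    ⟨0, measure_ne_top _ _⟩]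
  exact le_iInf fun n => (S n).2.le.trans (measure_mono subset_closure)

open Set Filter Topology in
theorem aux_analytic {X : Type*} [TopologicalSpace X] [T2Space X] [MeasurableSpace X]
    [OpensMeasurableSpace X] (μ : Measure X) [IsFiniteMeasure μ] (A : Set X)
    (hA : AnalyticSet A) : NullMeasurableSet A μ := by
  rw [AnalyticSet] at hA
  rcases hA with rfl | ⟨g, hg, rfl⟩
  · exact nullMeasurableSet_empty
  by_cases h0 : μ (range g) = 0
  · exact NullMeasurableSet.of_null h0
  obtain ⟨c, -, hc, hlim⟩ := exists_seq_strictMono_tendsto' (pos_iff_ne_zero.2 h0)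
  have := fun n => aux_inner μ g hg (c n) (hc n).2
  choose C hC hCm hcC using this
  have hsub : (⋃ n, C n) ⊆ range g := iUnion_subset hC
  have hm : MeasurableSet (⋃ n, C n) := MeasurableSet.iUnion hCm
  have hle : μ (range g) ≤ μ (⋃ n, C n) :=
    le_of_tendsto' hlim fun n => (hcC n).trans (measure_mono (subset_iUnion C n))
  exact hm.nullMeasurableSet.congr
    (ae_eq_of_subset_of_measure_ge hsub hle hm.nullMeasurableSet (measure_ne_top _ _))

theorem aux_reduce {Ω E : Type*} [MeasurableSpace Ω] [MeasurableSpace E] (G : Set (Ω × E))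
    (hG : MeasurableSet G) : ∃ (h : Ω → (ℕ → Bool)) (G' : Set ((ℕ → Bool) × E)),
      Measurable h ∧ MeasurableSet G' ∧ ∀ ω e, (ω, e) ∈ G ↔ (h ω, e) ∈ G' := by
  classical
  rw [← generateFrom_prod] at hG
  induction G, hG using MeasurableSpace.generateFrom_induction with
  | hC t ht _ =>
    obtain ⟨s, hs, t, ht, rfl⟩ := ht
    refine ⟨fun ω _ => decide (ω ∈ s), {b | b 0 = true} ×ˢ t, ?_, ?_, ?_⟩
    · refine measurable_pi_lambda _ fun _ => ?_
      refine measurable_to_bool ?_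
      have : (fun ω => decide (ω ∈ s)) ⁻¹' {true} = s := by ext; simp
      rw [this]; exact hs
    · refine MeasurableSet.prod ?_ ht
      exact (measurable_pi_apply (X := fun _ : ℕ => Bool) 0) (MeasurableSet.of_discrete (s := ({true} : Set Bool)))
    · intro ω e; simp
  | empty => exact ⟨fun _ _ => true, ∅, measurable_const, MeasurableSet.empty, by simp⟩
  | compl t _ ih =>
    obtain ⟨h, G', hh, hG', hiff⟩ := ih
    exact ⟨h, G'ᶜ, hh, hG'.compl, fun ω e => not_congr (hiff ω e)⟩
  | iUnion s _ ih =>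
    choose h G' hh hG' hiff using ih
    refine ⟨fun ω n => h n.unpair.1 ω n.unpair.2,
      ⋃ n, (fun p : (ℕ → Bool) × E => ((fun k => p.1 (Nat.pair n k)), p.2)) ⁻¹' G' n, ?_, ?_, ?_⟩
    · exact measurable_pi_lambda _ fun n => (measurable_pi_apply _).comp (hh _)
    · refine MeasurableSet.iUnion fun n => (?_ : Measurable _) (hG' n)
      refine Measurable.prodMk (measurable_pi_lambda _ fun k => ?_) measurable_snd
      exact (measurable_pi_apply _).comp measurable_fst
    · intro ω e
      simp [hiff]

open Set Filter Topology PiNat in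
theorem aux_sel {X : Type*} [TopologicalSpace X] [T2Space X] [MeasurableSpace X]
    [OpensMeasurableSpace X] (μ : Measure X) [IsFiniteMeasure μ] (g : (ℕ → ℕ) → X)
    (hg : Continuous g) : ∃ s : X → ℕ → ℕ, AEMeasurable s μ ∧ ∀ x ∈ range g, g (s x) = x := by
  classical
  let B : List ℕ → Set X := fun l => g '' {σ | res σ l.length = l}
  have hB : ∀ l, NullMeasurableSet (B l) μ := by
    intro l
    apply aux_analytic
    refine AnalyticSet.image_of_continuous (IsClosed.analyticSet ?_) hg
    by_cases h : ∃ σ, res σ l.length = l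
    · obtain ⟨σ, hσ⟩ := h
      have : {τ | res τ l.length = l} = ⋂ i : ℕ, ⋂ _ : i < l.length, {τ : ℕ → ℕ | τ i = σ i} := by
        ext τ
        conv_lhs => rw [mem_ofPred_eq, ← hσ, hσ, ← hσ]
        simp only [mem_iInter, mem_ofPred_eq, res_length]
        rw [res_eq_res]
      rw [this]
      exact isClosed_iInter fun i => isClosed_iInter fun _ =>
        isClosed_eq (continuous_apply i) continuous_const
    · have : {τ : ℕ → ℕ | res τ l.length = l} = ∅ := by
        ext τ; simp; intro h'; exact h ⟨τ, h'⟩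
      rw [this]; exact isClosed_empty
  let r : ℕ → X → List ℕ := fun n => Nat.rec (fun _ => [])
    (fun _ r x => sInf {k | x ∈ B (k :: r x)} :: r x) n
  have hr1 : ∀ n x, r (n+1) x = sInf {k | x ∈ B (k :: r n x)} :: r n x := fun n x => rfl
  have hlen : ∀ n x, (r n x).length = n := by
    intro n x
    induction n with
    | zero => rfl
    | succ n ih => rw [hr1, List.length_cons, ih]
  have hinf : ∀ l : List ℕ, ∀ k, NullMeasurableSet {x | sInf {k | x ∈ B (k :: l)} = k} μ := by
    intro l k
    have h2 : ∀ x, sInf {k | x ∈ B (k :: l)} = k ↔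
        ((x ∈ B (k :: l) ∧ ∀ j < k, x ∉ B (j :: l)) ∨ (k = 0 ∧ ∀ j, x ∉ B (j :: l))) := by
      intro x
      constructor
      · rintro rfl
        by_cases hne : {k | x ∈ B (k :: l)}.Nonempty
        · left
          exact ⟨Nat.sInf_mem hne, fun j hj => Nat.notMem_of_lt_sInf hj⟩
        · right
          rw [not_nonempty_iff_eq_empty] at hne
          exact ⟨by rw [hne]; exact Nat.sInf_empty, fun j hj => by
            have : j ∈ {k | x ∈ B (k :: l)} := hj
            rw [hne] at this; exact this⟩
      · rintro (⟨h, h'⟩ | ⟨rfl, h⟩)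
        · apply le_antisymm (Nat.sInf_le h)
          by_contra hlt
          push Not at hlt
          exact h' _ hlt (Nat.sInf_mem (s := {k | x ∈ B (k :: l)}) ⟨k, h⟩)
        · have : {k | x ∈ B (k :: l)} = ∅ := by ext j; simp [h j]
          rw [this]; exact Nat.sInf_empty
    have h3 : {x | sInf {k | x ∈ B (k :: l)} = k} =
        (B (k :: l) ∩ ⋂ j : ℕ, ⋂ _ : j < k, (B (j :: l))ᶜ) ∪ ((if k = 0 then univ else ∅) ∩ ⋂ j : ℕ, (B (j :: l))ᶜ) := by
      ext x
      rw [mem_ofPred_eq, h2]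
      by_cases hk : k = 0 <;> simp [hk]
    rw [h3]
    refine ((hB _).inter ?_).union (NullMeasurableSet.inter ?_ ?_)
    · exact NullMeasurableSet.iInter fun j => NullMeasurableSet.iInter fun _ => (hB _).compl
    · split_ifs
      · exact nullMeasurableSet_univ
      · exact nullMeasurableSet_empty
    · exact NullMeasurableSet.iInter fun j => (hB _).compl
  have hrm : ∀ n l, NullMeasurableSet {x | r n x = l} μ := by
    intro n
    induction n with
    | zero =>
      intro l
      by_cases h : l = []
      · subst h
        have : {x : X | r 0 x = []} = univ := by ext; simp [r]
        rw [this]; exact nullMeasurableSet_univ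
      · have : {x : X | r 0 x = l} = ∅ := by
          ext x
          simp only [mem_ofPred_eq, mem_empty_iff_false, iff_false]
          exact fun h' => h h'.symm
        rw [this]; exact nullMeasurableSet_empty
    | succ n ih =>
      intro l
      cases l with
      | nil =>
        have : {x : X | r (n+1) x = []} = ∅ := by ext; simp [hr1]
        rw [this]; exact nullMeasurableSet_empty
      | cons k l =>
        have : {x : X | r (n+1) x = k :: l} =
            {x | r n x = l} ∩ {x | sInf {k | x ∈ B (k :: l)} = k} := by
          ext x
          simp only [hr1, mem_ofPred_eq, mem_inter_iff, List.cons.injEq]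
          constructor
          · rintro ⟨h1, h2⟩
            rw [h2] at h1; exact ⟨h2, h1⟩
          · rintro ⟨h1, h2⟩
            rw [h1]; exact ⟨h2, rfl⟩
        rw [this]
        exact (ih l).inter (hinf l k)
  let s : X → ℕ → ℕ := fun x n => sInf {k | x ∈ B (k :: r n x)}
  have hres : ∀ x n, r n x = res (s x) n := by
    intro x n
    induction n with
    | zero => rfl
    | succ n ih => rw [hr1, res_succ, ← ih]
  refine ⟨s, ?_, ?_⟩
  · rw [aemeasurable_pi_iff]
    intro n
    apply NullMeasurable.aemeasurable
    intro t _
    have : (fun x => s x n) ⁻¹' t = ⋃ k ∈ t, ⋃ l : List ℕ, {x | r (n+1) x = k :: l} := by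
      ext x
      simp only [mem_preimage, mem_iUnion, mem_ofPred_eq, hr1, List.cons.injEq]
      constructor
      · intro h
        exact ⟨_, h, _, rfl, rfl⟩
      · rintro ⟨k, hk, l, h1, h2⟩
        rw [← h1] at hk
        exact hk
    rw [this]
    exact NullMeasurableSet.biUnion (to_countable t) fun k _ =>
      NullMeasurableSet.iUnion fun l => hrm (n+1) (k :: l)
  · intro x hx
    have hxB : ∀ n, x ∈ B (r n x) := by
      intro n
      induction n with
      | zero =>
        obtain ⟨σ, rfl⟩ := hx
        exact ⟨σ, rfl, rfl⟩
      | succ n ih =>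
        rw [hr1]
        apply Nat.sInf_mem (s := {k | x ∈ B (k :: r n x)})
        obtain ⟨σ, hσ, hgσ⟩ := ih
        refine ⟨σ n, σ, ?_, hgσ⟩
        rw [mem_ofPred_eq] at hσ ⊢
        rw [List.length_cons, res_succ, hσ, hlen]
    choose σ hσ hgσ using hxB
    have hlim : Tendsto σ atTop (𝓝 (s x)) := by
      rw [tendsto_pi_nhds]
      intro i
      apply tendsto_const_nhds.congr'
      filter_upwards [eventually_gt_atTop i] with n hn
      have := hσ n
      rw [mem_ofPred_eq, hlen, hres, res_eq_res] at this
      exact (this hn).symm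
    have h1 := (hg.tendsto (s x)).comp hlim
    have h2 : Tendsto (g ∘ σ) atTop (𝓝 x) := by
      apply tendsto_const_nhds.congr
      intro n; exact (hgσ n).symm
    exact tendsto_nhds_unique h1 h2

/-- Measurable projection and selection. -/
theorem aux_proj_sel {Ω E : Type*} [MeasurableSpace Ω] (P : Measure Ω) [IsFiniteMeasure P]
    [TopologicalSpace E] [PolishSpace E] [MeasurableSpace E] [BorelSpace E] [Inhabited E]
    (G : Set (Ω × E)) (hG : MeasurableSet G) :
    NullMeasurableSet {ω | ∃ e, (ω, e) ∈ G} P ∧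
    ∃ u : Ω → E, Measurable u ∧ ∀ᵐ ω ∂P, (∃ e, (ω, e) ∈ G) → (ω, u ω) ∈ G := by
  obtain ⟨h, G', hh, hG', hiff⟩ := aux_reduce G hG
  have : PolishSpace Bool := inferInstance
  have : PolishSpace (ℕ → Bool) := inferInstance
  have hA : AnalyticSet G' := hG'.analyticSet
  constructor
  · have h1 : {ω | ∃ e, (ω, e) ∈ G} = h ⁻¹' (Prod.fst '' G') := by
      ext ω
      simp [hiff]
    rw [h1]
    have := aux_analytic (P.map h) _ (hA.image_of_continuous continuous_fst)
    exact this.preimage ⟨hh, Measure.AbsolutelyContinuous.rfl⟩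
  · rw [AnalyticSet] at hA
    rcases hA with h0 | ⟨g, hg, hrg⟩
    · refine ⟨fun _ => default, measurable_const, ?_⟩
      simp [hiff, h0]
    · obtain ⟨s, hs, hsel⟩ := aux_sel (P.map h) (fun σ => (g σ).1) (continuous_fst.comp hg)
      have hsm : AEMeasurable (fun ω => s (h ω)) P := hs.comp_measurable hh
      have hum : AEMeasurable (fun ω => (g (s (h ω))).2) P :=
        (continuous_snd.comp hg).measurable.comp_aemeasurable hsm
      refine ⟨hum.mk _, hum.measurable_mk, ?_⟩
      filter_upwards [hum.ae_eq_mk] with ω hω hex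
      rw [← hω, hiff]
      obtain ⟨e, he⟩ := hex
      rw [hiff, ← hrg] at he
      obtain ⟨σ, hσ⟩ := he
      have h3 := hsel (h ω) ⟨σ, by simp [hσ]⟩
      rw [← hrg]
      refine ⟨s (h ω), ?_⟩
      exact Prod.ext h3 rfl

theorem EE_le_aux {Ω : Type} [MeasurableSpace Ω] (P : Measure Ω) (φ : Ω → EReal) (β : Ω → ℝ)
    (hβ : Integrable β P) (h : ∀ᵐ ω ∂P, φ ω ≤ (β ω : EReal)) :
    EE P φ ≤ ((∫ ω, β ω ∂P : ℝ) : EReal) := by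
  have e1 : ∀ a : EReal, epos a = a.toENNReal := fun a => rfl
  have h1 : ∫⁻ ω, epos (φ ω) ∂P ≤ ∫⁻ ω, ENNReal.ofReal (β ω) ∂P := by
    apply lintegral_mono_ae
    filter_upwards [h] with ω hω
    rw [e1, ← EReal.real_coe_toENNReal]
    exact EReal.toENNReal_le_toENNReal hω
  have h2 : ∫⁻ ω, ENNReal.ofReal (-β ω) ∂P ≤ ∫⁻ ω, epos (-(φ ω)) ∂P := by
    apply lintegral_mono_ae
    filter_upwards [h] with ω hω
    rw [e1, ← EReal.real_coe_toENNReal]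
    apply EReal.toENNReal_le_toENNReal
    rw [EReal.coe_neg]
    exact EReal.neg_le_neg_iff.2 hω
  have f1 : ∫⁻ ω, ENNReal.ofReal (β ω) ∂P ≠ ⊤ := hβ.lintegral_lt_top.ne
  have f2 : ∫⁻ ω, ENNReal.ofReal (-β ω) ∂P ≠ ⊤ := hβ.neg.lintegral_lt_top.ne
  rw [EE, if_neg (ne_top_of_le_ne_top f1 h1), integral_eq_lintegral_pos_part_sub_lintegral_neg_part hβ,
    EReal.coe_sub]
  refine EReal.sub_le_sub ?_ ?_
  · rw [EReal.coe_ennreal_toReal f1]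
    exact EReal.coe_ennreal_le_coe_ennreal_iff.2 h1
  · rw [EReal.coe_ennreal_toReal f2]
    exact EReal.coe_ennreal_le_coe_ennreal_iff.2 h2

open Filter Topology in
theorem EE_lt_aux {Ω : Type} [MeasurableSpace Ω] (P : Measure Ω) [IsProbabilityMeasure P]
    (φ : Ω → EReal) (hφ : AEMeasurable φ P) (c : ℝ) (h : EE P φ < (c : EReal)) :
    ∃ β : Ω → ℝ, Integrable β P ∧ (∀ᵐ ω ∂P, φ ω < (β ω : EReal)) ∧ ∫ ω, β ω ∂P < c := by
  have e1 : ∀ a : EReal, epos a = a.toENNReal := fun a => rfl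
  have mp : AEMeasurable (fun ω => epos (φ ω)) P := hφ.ereal_toENNReal
  have mq : AEMeasurable (fun ω => epos (-(φ ω))) P :=
    (measurable_ereal_toENNReal.comp measurable_neg).comp_aemeasurable hφ
  rw [EE] at h
  split_ifs at h with htop
  · simp at h
  set p : Ω → ℝ≥0∞ := fun ω => epos (φ ω) with hp
  set q : Ω → ℝ≥0∞ := fun ω => epos (-(φ ω)) with hq
  have hlim : Tendsto (fun k : ℕ => ∫⁻ ω, min (q ω) (k : ℝ≥0∞) ∂P) atTop (𝓝 (∫⁻ ω, q ω ∂P)) := by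
    apply lintegral_tendsto_of_tendsto_of_monotone
    · intro n; exact mq.min aemeasurable_const
    · refine Eventually.of_forall fun ω a b hab => ?_
      exact min_le_min le_rfl (by exact_mod_cast hab)
    · refine Eventually.of_forall fun ω => ?_
      have := (tendsto_const_nhds (x := q ω)).min ENNReal.tendsto_nat_nhds_top
      simpa using this
  have hk : ∃ k : ℕ, ((∫⁻ ω, p ω ∂P).toReal - c : ℝ) < (∫⁻ ω, min (q ω) (k : ℝ≥0∞) ∂P).toReal := by
    have hfin : ∀ k : ℕ, ∫⁻ ω, min (q ω) (k : ℝ≥0∞) ∂P ≠ ⊤ := by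
      intro k
      refine ne_top_of_le_ne_top (b := (k : ℝ≥0∞)) (by simp) ?_
      calc _ ≤ ∫⁻ ω, (k : ℝ≥0∞) ∂P := lintegral_mono fun ω => min_le_right _ _
        _ = _ := by simp
    have hlim' := (EReal.continuous_coe_ennreal_iff.2 continuous_id |>.tendsto _).comp hlim
    have hlt : (((∫⁻ ω, p ω ∂P).toReal - c : ℝ) : EReal) < ((∫⁻ ω, q ω ∂P : ℝ≥0∞) : EReal) := by
      rw [EReal.coe_sub, EReal.coe_ennreal_toReal htop]
      rw [← EReal.coe_ennreal_toReal htop] at h ⊢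
      generalize ((∫⁻ ω, q ω ∂P : ℝ≥0∞) : EReal) = Q at *
      induction Q with
      | bot => simp at h
      | top => exact EReal.coe_lt_top _
      | coe Q => norm_cast at h ⊢; linarith
    obtain ⟨k, hk⟩ := (hlim'.eventually (lt_mem_nhds hlt)).exists
    refine ⟨k, ?_⟩
    simp only [Function.comp, id] at hk
    rw [← EReal.coe_ennreal_toReal (hfin k)] at hk
    exact_mod_cast hk
  obtain ⟨k, hk⟩ := hk
  set ip := (∫⁻ ω, p ω ∂P).toReal
  set iq := (∫⁻ ω, min (q ω) (k : ℝ≥0∞) ∂P).toReal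
  have intp : Integrable (fun ω => (p ω).toReal) P := integrable_toReal_of_lintegral_ne_top mp htop
  have finq : ∫⁻ ω, min (q ω) (k : ℝ≥0∞) ∂P ≠ ⊤ := by
    refine ne_top_of_le_ne_top (b := (k : ℝ≥0∞)) (by simp) ?_
    calc _ ≤ ∫⁻ ω, (k : ℝ≥0∞) ∂P := lintegral_mono fun ω => min_le_right _ _
      _ = _ := by simp
  have mqk : AEMeasurable (fun ω => min (q ω) (k : ℝ≥0∞)) P := mq.min aemeasurable_const
  have intq : Integrable (fun ω => (min (q ω) (k : ℝ≥0∞)).toReal) P :=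
    integrable_toReal_of_lintegral_ne_top mqk finq
  have aep : ∀ᵐ ω ∂P, p ω < ⊤ := ae_lt_top' mp htop
  have Ip : ∫ ω, (p ω).toReal ∂P = ip := integral_toReal mp aep
  have Iq : ∫ ω, (min (q ω) (k : ℝ≥0∞)).toReal ∂P = iq :=
    integral_toReal mqk (ae_lt_top' mqk finq)
  obtain ⟨ε, hε, hε2⟩ : ∃ ε : ℝ, 0 < ε ∧ ip - iq + ε < c :=
    ⟨(c - (ip - iq)) / 2, by linarith, by linarith⟩
  refine ⟨fun ω => (p ω).toReal - (min (q ω) (k : ℝ≥0∞)).toReal + ε,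
    (intp.sub intq).add (integrable_const _), ?_, ?_⟩
  · filter_upwards [aep] with ω hω
    have hne : φ ω ≠ ⊤ := by
      intro h'
      simp [hp, e1, h'] at hω
    simp only [hp, hq, e1]
    generalize φ ω = a at hne
    induction a with
    | bot => exact EReal.bot_lt_coe _
    | top => exact absurd rfl hne
    | coe a =>
      rw [← EReal.coe_neg, EReal.real_coe_toENNReal, EReal.real_coe_toENNReal]
      rw [EReal.coe_lt_coe_iff]
      have h1 : (min (ENNReal.ofReal (-a)) (k : ℝ≥0∞)).toReal ≤ max (-a) 0 := by
        rw [← ENNReal.toReal_ofReal']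
        exact ENNReal.toReal_mono ENNReal.ofReal_ne_top (min_le_left _ _)
      rw [ENNReal.toReal_ofReal']
      rcases le_total a 0 with h | h
      · rw [max_eq_left (by linarith : 0 ≤ -a)] at h1
        have := le_max_right a 0
        linarith
      · rw [max_eq_right (by linarith : -a ≤ 0)] at h1
        have := le_max_left a 0
        linarith
  · have e3 : ∫ ω, ((p ω).toReal - (min (q ω) (k : ℝ≥0∞)).toReal + ε) ∂P = ip - iq + ε := by
      have e4 : Integrable (fun ω => (p ω).toReal - (min (q ω) (k : ℝ≥0∞)).toReal) P :=
        intp.sub intq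
      rw [integral_add e4 (integrable_const _), integral_sub intp intq, Ip, Iq]
      simp
    exact e3.trans_lt hε2

theorem lt_shift (a : EReal) (b d : ℝ) : a - (d : EReal) < (b : EReal) ↔ a < ((b + d : ℝ) : EReal) := by
  induction a with
  | bot => simp [EReal.bot_lt_coe]
  | top => simp
  | coe a => norm_cast; constructor <;> intro h <;> linarith

theorem measurable_dotM {Ω : Type} [MeasurableSpace Ω] {m : ℕ} {u y : Ω → Fin m → ℝ}
    (hu : Measurable u) (hy : Measurable y) : Measurable fun ω => dotM (u ω) (y ω) := by
  unfold dotM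
  fun_prop

theorem lagr_lt {Ω : Type} {T : ℕ} {nt : Fin (T+1) → ℕ} {m : ℕ}
    (f : Vec nt → (Fin m → ℝ) → Ω → EReal) (x : Vec nt) (y : Fin m → ℝ) (ω : Ω) (b : ℝ) :
    lagr f x y ω < (b : EReal) ↔ ∃ u, f x u ω < ((b + dotM u y : ℝ) : EReal) := by
  unfold lagr
  rw [iInf_lt_iff]
  simp only [lt_shift]

theorem measG {Ω : Type} [MeasurableSpace Ω] {T : ℕ} {nt : Fin (T+1) → ℕ} {m : ℕ}
    (f : Vec nt → (Fin m → ℝ) → Ω → EReal)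
    (hf_meas : Measurable (fun p : (Vec nt × (Fin m → ℝ)) × Ω => f p.1.1 p.1.2 p.2))
    (x : Ω → Vec nt) (hx : Measurable x) (y : Ω → Fin m → ℝ) (hy : Measurable y)
    (β : Ω → ℝ) (hβ : Measurable β) :
    MeasurableSet {p : Ω × (Fin m → ℝ) |
      f (x p.1) p.2 p.1 < ((β p.1 + dotM p.2 (y p.1) : ℝ) : EReal)} := by
  refine measurableSet_lt ?_ ?_
  · exact hf_meas.comp (((hx.comp measurable_fst).prodMk measurable_snd).prodMk measurable_fst)
  · unfold dotM
    refine measurable_coe_real_ereal.comp ?_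
    fun_prop

theorem aemeas_lagr {Ω : Type} [MeasurableSpace Ω] (P : Measure Ω) [IsProbabilityMeasure P]
    {T : ℕ} {nt : Fin (T+1) → ℕ} {m : ℕ}
    (f : Vec nt → (Fin m → ℝ) → Ω → EReal)
    (hf_meas : Measurable (fun p : (Vec nt × (Fin m → ℝ)) × Ω => f p.1.1 p.1.2 p.2))
    (x : Ω → Vec nt) (hx : Measurable x) (y : Ω → Fin m → ℝ) (hy : Measurable y) :
    AEMeasurable (fun ω => lagr f (x ω) (y ω) ω) P := by
  have key : ∀ b : ℝ, NullMeasurableSet {ω | lagr f (x ω) (y ω) ω < (b : EReal)} P := by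
    intro b
    have := (aux_proj_sel P _ (measG f hf_meas x hx y hy (fun _ => b) measurable_const)).1
    convert this using 1
    ext ω
    exact lagr_lt f (x ω) (y ω) ω b
  apply NullMeasurable.aemeasurable
  have : @Measurable (NullMeasurableSpace Ω P) EReal _ _ (fun ω => lagr f (x ω) (y ω) ω) := by
    refine measurable_of_Iio fun a => ?_
    have hU : (fun ω => lagr f (x ω) (y ω) ω) ⁻¹' Set.Iio a =
        ⋃ b : ℚ, if ((b : ℝ) : EReal) ≤ a then {ω | lagr f (x ω) (y ω) ω < ((b : ℝ) : EReal)} else ∅ := by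
      ext ω
      simp only [Set.mem_preimage, Set.mem_Iio, Set.mem_iUnion]
      constructor
      · intro h
        obtain ⟨b, h1, h2⟩ := EReal.lt_iff_exists_rat_btwn.1 h
        refine ⟨b, ?_⟩
        rw [if_pos h2.le]
        exact h1
      · rintro ⟨b, hb⟩
        split_ifs at hb with h1
        · exact lt_of_lt_of_le hb h1
        · exact hb.elim
    have hN : NullMeasurableSet ((fun ω => lagr f (x ω) (y ω) ω) ⁻¹' Set.Iio a) P := by
      rw [hU]
      refine NullMeasurableSet.iUnion fun b => ?_
      split_ifs
      · exact key b
      · exact nullMeasurableSet_empty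
    exact hN
  exact this

theorem meas_of_N {Ω : Type} [mΩ : MeasurableSpace Ω] {T : ℕ} (ℱ : Fin (T+1) → MeasurableSpace Ω)
    (hℱ_le : ∀ t, ℱ t ≤ mΩ) (nt : Fin (T+1) → ℕ) (x : Ω → Vec nt) (hx : x ∈ Nspace nt ℱ) :
    Measurable x :=
  measurable_pi_lambda _ fun t => (hx t).mono (hℱ_le t) le_rfl

open Filter Topology in
theorem step_dom
    {Ω : Type} [mΩ : MeasurableSpace Ω] (P : Measure Ω) [IsProbabilityMeasure P]
    {T : ℕ} (nt : Fin (T+1) → ℕ) {m : ℕ}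
    (f : Vec nt → (Fin m → ℝ) → Ω → EReal)
    (hf_meas : Measurable (fun p : (Vec nt × (Fin m → ℝ)) × Ω => f p.1.1 p.1.2 p.2))
    (𝓤 : Set (Ω → Fin m → ℝ))
    (h𝓤meas : ∀ u ∈ 𝓤, Measurable u)
    (h𝓤dec : Decomposable P 𝓤)
    (y : Ω → Fin m → ℝ) (hy : Measurable y)
    (hpair : ∀ u ∈ 𝓤, Integrable (fun ω => dotM (u ω) (y ω)) P)
    (x : Ω → Vec nt) (hx : Measurable x) (u₀ : Ω → Fin m → ℝ) (hu₀ : u₀ ∈ 𝓤)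
    (hfin : intF P f x u₀ < ⊤)
    (β : Ω → ℝ) (hβ : Integrable β P) (hlβ : ∀ᵐ ω ∂P, lagr f (x ω) (y ω) ω < (β ω : EReal))
    (c : ℝ) (hc : ∫ ω, β ω ∂P < c) :
    ∃ u ∈ 𝓤, intF P f x u < ((c + pairing P u y : ℝ) : EReal) := by
  classical
  have hu₀m := h𝓤meas u₀ hu₀
  obtain ⟨c', hc', -⟩ := EReal.lt_iff_exists_real_btwn.1 hfin
  obtain ⟨γ, hγ, hfγ, -⟩ := EE_lt_aux P _
    (hf_meas.comp ((hx.prodMk hu₀m).prodMk measurable_id)).aemeasurable c' hc'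
  have hβm := hβ.1.aemeasurable
  obtain ⟨w, hw, hsel⟩ := (aux_proj_sel P _ (measG f hf_meas x hx y hy
    (hβm.mk β) hβm.measurable_mk)).2
  have hsel' : ∀ᵐ ω ∂P, f (x ω) (w ω) ω < ((β ω + dotM (w ω) (y ω) : ℝ) : EReal) := by
    filter_upwards [hsel, hlβ, hβm.ae_eq_mk] with ω h1 h2 h3
    rw [lagr_lt, h3] at h2
    rw [h3]
    exact h1 h2
  let A : ℕ → Set Ω := fun n => {ω | (n : ℝ) < ‖w ω‖}
  have hA : ∀ n, MeasurableSet (A n) := fun n => measurableSet_lt measurable_const hw.norm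
  let u : ℕ → Ω → Fin m → ℝ := fun n ω =>
    (A n).indicator u₀ ω + (A n)ᶜ.indicator ((A n)ᶜ.indicator w) ω
  have huU : ∀ n, u n ∈ 𝓤 := by
    intro n
    refine h𝓤dec (A n) (hA n) u₀ hu₀ _ (hw.indicator (hA n).compl) ⟨n, ?_⟩
    refine Eventually.of_forall fun ω => ?_
    by_cases h : ω ∈ (A n)ᶜ
    · rw [Set.indicator_of_mem h]
      exact not_lt.1 h
    · rw [Set.indicator_of_notMem h]
      simp
  have hu1 : ∀ n ω, ω ∈ A n → u n ω = u₀ ω := by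
    intro n ω h; simp [u, h]
  have hu2 : ∀ n ω, ω ∉ A n → u n ω = w ω := by
    intro n ω h; simp [u, h]
  let ρ : Ω → ℝ := fun ω => γ ω - dotM (u₀ ω) (y ω)
  have hρ : Integrable ρ P := hγ.sub (hpair u₀ hu₀)
  let ξ : ℕ → Ω → ℝ := fun n ω => (A n).indicator ρ ω + (A n)ᶜ.indicator β ω
  have hξ : ∀ n, Integrable (ξ n) P := fun n =>
    (hρ.indicator (hA n)).add (hβ.indicator (hA n).compl)
  have hlim : Tendsto (fun n => ∫ ω, ξ n ω ∂P) atTop (𝓝 (∫ ω, β ω ∂P)) := by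
    refine tendsto_integral_of_dominated_convergence (fun ω => ‖ρ ω‖ + ‖β ω‖)
      (fun n => (hξ n).1) (hρ.norm.add hβ.norm) (fun n => Eventually.of_forall fun ω => ?_)
      (Eventually.of_forall fun ω => ?_)
    · exact (norm_add_le _ _).trans (add_le_add (norm_indicator_le_norm_self _ _)
        (norm_indicator_le_norm_self _ _))
    · apply tendsto_const_nhds.congr'
      obtain ⟨N, hN⟩ := exists_nat_ge ‖w ω‖
      filter_upwards [eventually_ge_atTop N] with n hn
      have : ω ∉ A n := by
        simp only [A, Set.mem_ofPred_eq, not_lt]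
        exact hN.trans (by exact_mod_cast hn)
      simp [ξ, this]
  obtain ⟨n, hn⟩ := (hlim.eventually (gt_mem_nhds hc)).exists
  refine ⟨u n, huU n, ?_⟩
  have hint := hpair _ (huU n)
  refine lt_of_le_of_lt (EE_le_aux P _ (fun ω => ξ n ω + dotM (u n ω) (y ω)) ((hξ n).add hint) ?_) ?_
  · filter_upwards [hsel', hfγ] with ω h1 h2
    by_cases h : ω ∈ A n
    · rw [hu1 n ω h]
      have : ξ n ω = γ ω - dotM (u₀ ω) (y ω) := by simp [ξ, h, ρ]
      rw [this, sub_add_cancel]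
      exact h2.le
    · rw [hu2 n ω h]
      have : ξ n ω = β ω := by simp [ξ, h]
      rw [this]
      exact h1.le
  · rw [integral_add (hξ n) hint, EReal.coe_lt_coe_iff]
    unfold pairing
    linarith

/-- if `{x ∈ 𝓝^∞ : El(x,y) < ∞} ⊆ acl(dom₁Ef ∩ 𝓝^∞)`, then
`φ̃*(y) = −inf_{x∈𝓝^∞} El(x,y)`. -/
theorem stmt_1
    {Ω : Type} [mΩ : MeasurableSpace Ω] (P : Measure Ω) [IsProbabilityMeasure P]
    {T : ℕ} (ℱ : Fin (T+1) → MeasurableSpace Ω)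
    (hℱ_le : ∀ t, ℱ t ≤ mΩ) (hℱ_mono : Monotone ℱ)
    (nt : Fin (T+1) → ℕ) {m : ℕ}
    -- `f` is a convex normal integrand
    (f : Vec nt → (Fin m → ℝ) → Ω → EReal)
    (hf_meas : Measurable (fun p : (Vec nt × (Fin m → ℝ)) × Ω => f p.1.1 p.1.2 p.2))
    (hf_proper : ∀ ω, (∀ x u, f x u ω ≠ ⊥) ∧ ∃ x u, f x u ω ≠ ⊤)
    (hf_lsc : ∀ ω, LowerSemicontinuous (fun p : Vec nt × (Fin m → ℝ) => f p.1 p.2 ω))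
    (hf_convex : ∀ (ω : Ω) (a b : ℝ) (x₁ x₂ : Vec nt) (u₁ u₂ : Fin m → ℝ),
      0 < a → 0 < b → a + b = 1 →
      f (a • x₁ + b • x₂) (a • u₁ + b • u₂) ω ≤
        (a : EReal) * f x₁ u₁ ω + (b : EReal) * f x₂ u₂ ω)
    -- `𝓤` and `𝓨` are decomposable subspaces of `L⁰` in separating duality
    (𝓤 𝓨 : Set (Ω → Fin m → ℝ))
    (h𝓤meas : ∀ u ∈ 𝓤, Measurable u) (h𝓨meas : ∀ y ∈ 𝓨, Measurable y)
    (h𝓤sub : ∀ u ∈ 𝓤, ∀ u' ∈ 𝓤, ∀ c : ℝ, u + u' ∈ 𝓤 ∧ c • u ∈ 𝓤)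
    (h𝓨sub : ∀ y ∈ 𝓨, ∀ y' ∈ 𝓨, ∀ c : ℝ, y + y' ∈ 𝓨 ∧ c • y ∈ 𝓨)
    (h𝓤dec : Decomposable P 𝓤) (h𝓨dec : Decomposable P 𝓨)
    (hpair : ∀ u ∈ 𝓤, ∀ y ∈ 𝓨, Integrable (fun ω => dotM (u ω) (y ω)) P)
    (hsep𝓤 : ∀ u ∈ 𝓤, (∀ y ∈ 𝓨, pairing P u y = 0) → u =ᵐ[P] (fun _ => 0))
    (hsep𝓨 : ∀ y ∈ 𝓨, (∀ u ∈ 𝓤, pairing P u y = 0) → y =ᵐ[P] (fun _ => 0))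
    (y : Ω → Fin m → ℝ) (hy : y ∈ 𝓨)
    (hdom : {x | x ∈ NspaceInf nt ℱ P ∧ intL P f x y < ⊤} ⊆
      acl (dom1intF P f ℱ 𝓤 ∩ NspaceInf nt ℱ P)) :
    conj P 𝓤 (valueFnInf P f ℱ) y = - ⨅ x ∈ NspaceInf nt ℱ P, intL P f x y := by
  classical
  have hym := h𝓨meas y hy
  have hpair' : ∀ u ∈ 𝓤, Integrable (fun ω => dotM (u ω) (y ω)) P := fun u hu => hpair u hu y hy
  apply le_antisymm
  · unfold conj
    refine iSup₂_le fun u hu => ?_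
    rw [EReal.le_neg]
    have hum := h𝓤meas u hu
    -- `inf El ≤ -(⟨u,y⟩ - φ̃ u)`
    have key : ∀ c : ℝ, valueFnInf P f ℱ u < (c : EReal) →
        (⨅ x ∈ NspaceInf nt ℱ P, intL P f x y) ≤ ((c - pairing P u y : ℝ) : EReal) := by
      intro c hc
      unfold valueFnInf at hc
      simp only [iInf_lt_iff] at hc
      obtain ⟨x, hx, hxc⟩ := hc
      have hxm := meas_of_N ℱ hℱ_le nt x hx.1
      obtain ⟨β, hβ, hfβ, hβc⟩ := EE_lt_aux P _
        (hf_meas.comp ((hxm.prodMk hum).prodMk measurable_id)).aemeasurable c hxc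
      refine (iInf₂_le x hx).trans ?_
      refine (EE_le_aux P _ (fun ω => β ω - dotM (u ω) (y ω)) (hβ.sub (hpair' u hu)) ?_).trans ?_
      · filter_upwards [hfβ] with ω hω
        refine le_of_lt ?_
        rw [lagr_lt]
        exact ⟨u ω, by rw [sub_add_cancel]; exact hω⟩
      · rw [integral_sub hβ (hpair' u hu), EReal.coe_le_coe_iff]
        unfold pairing
        linarith
    generalize (⨅ x ∈ NspaceInf nt ℱ P, intL P f x y) = I at key
    generalize valueFnInf P f ℱ u = v at key
    refine EReal.le_of_forall_lt_iff_le.1 fun z hz => ?_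
    have hz' : v < ((z + pairing P u y : ℝ) : EReal) := by
      induction v with
      | bot => exact EReal.bot_lt_coe _
      | top => simp at hz
      | coe v => norm_cast at hz ⊢; linarith
    have := key _ hz'
    simpa using this
  · rw [EReal.neg_le]
    refine le_iInf₂ fun x hx => ?_
    refine EReal.le_of_forall_lt_iff_le.1 fun c hc => ?_
    rw [EReal.neg_le]
    have hxm := meas_of_N ℱ hℱ_le nt x hx.1
    obtain ⟨β, hβ, hlβ, hβc⟩ := EE_lt_aux P _ (aemeas_lagr P f hf_meas x hxm y hym) c hc
    obtain ⟨z, ⟨⟨hzN, u₁, hu₁, hfu₁⟩, hzI⟩, hseg⟩ := hdom ⟨hx, hc.trans (EReal.coe_lt_top c)⟩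
    have hzm := meas_of_N ℱ hℱ_le nt z hzN
    obtain ⟨c', hc', -⟩ := EReal.lt_iff_exists_real_btwn.1 hfu₁
    obtain ⟨γ, hγ, hfγ, -⟩ := EE_lt_aux P _
      (hf_meas.comp ((hzm.prodMk (h𝓤meas u₁ hu₁)).prodMk measurable_id)).aemeasurable c' hc'
    have hδ : Integrable (fun ω => γ ω - dotM (u₁ ω) (y ω)) P := hγ.sub (hpair' u₁ hu₁)
    obtain ⟨lam, hl0, hl1, hlc⟩ : ∃ lam : ℝ, 0 < lam ∧ lam < 1 ∧
        (1 - lam) * ∫ ω, β ω ∂P + lam * ∫ ω, (γ ω - dotM (u₁ ω) (y ω)) ∂P < c := by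
      have hcont : Filter.Tendsto (fun lam : ℝ => (1 - lam) * ∫ ω, β ω ∂P +
          lam * ∫ ω, (γ ω - dotM (u₁ ω) (y ω)) ∂P) (nhdsWithin 0 (Set.Ioi 0))
          (nhds (∫ ω, β ω ∂P)) := by
        have : Continuous (fun lam : ℝ => (1 - lam) * ∫ ω, β ω ∂P +
          lam * ∫ ω, (γ ω - dotM (u₁ ω) (y ω)) ∂P) := by fun_prop
        have h2 := this.tendsto 0
        simp only [sub_zero, one_mul, zero_mul, add_zero] at h2
        exact h2.mono_left nhdsWithin_le_nhds
      have h3 : ∀ᶠ lam : ℝ in nhdsWithin 0 (Set.Ioi 0), lam ∈ Set.Ioo (0:ℝ) 1 :=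
        Ioo_mem_nhdsGT one_pos
      obtain ⟨lam, h4, h5⟩ := ((hcont.eventually (gt_mem_nhds hβc)).and h3).exists
      exact ⟨lam, h5.1, h5.2, h4⟩
    obtain ⟨⟨hxlN, u₀, hu₀, hfu₀⟩, hxlI⟩ := hseg lam hl0 hl1.le
    have hxlm := meas_of_N ℱ hℱ_le nt _ hxlN
    obtain ⟨u, hu, hfin⟩ := step_dom P nt f hf_meas 𝓤 h𝓤meas h𝓤dec y hym hpair' _ hxlm u₀ hu₀ hfu₀
      (fun ω => (1 - lam) * β ω + lam * (γ ω - dotM (u₁ ω) (y ω)))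
      ((hβ.const_mul _).add (hδ.const_mul _)) (by
        filter_upwards [hlβ, hfγ] with ω h1 h2
        rw [lagr_lt] at h1 ⊢
        obtain ⟨v, hv⟩ := h1
        refine ⟨(1 - lam) • v + lam • u₁ ω, ?_⟩
        refine lt_of_le_of_lt (hf_convex ω (1 - lam) lam (x ω) (z ω) v (u₁ ω) (by linarith) hl0
          (by ring)) ?_
        have hd : dotM ((1 - lam) • v + lam • u₁ ω) (y ω) =
            (1 - lam) * dotM v (y ω) + lam * dotM (u₁ ω) (y ω) := by
          simp only [dotM, Finset.mul_sum, ← Finset.sum_add_distrib]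
          refine Finset.sum_congr rfl fun j _ => ?_
          simp only [Pi.add_apply, Pi.smul_apply, smul_eq_mul]
          ring
        rw [hd]
        have hb1 := (hf_proper ω).1 (x ω) v
        have hb2 := (hf_proper ω).1 (z ω) (u₁ ω)
        change f (z ω) (u₁ ω) ω < _ at h2
        generalize f (x ω) v ω = a at hv hb1 ⊢
        generalize f (z ω) (u₁ ω) ω = b at h2 hb2 ⊢
        induction a with
        | bot => exact absurd rfl hb1
        | top => simp at hv
        | coe a =>
          induction b with
          | bot => exact absurd rfl hb2
          | top => simp at h2
          | coe b =>
            norm_cast at hv h2 ⊢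
            have e1 := mul_lt_mul_of_pos_left hv (by linarith : 0 < 1 - lam)
            have e2 := mul_lt_mul_of_pos_left h2 hl0
            nlinarith) c (by
        rw [integral_add (hβ.const_mul _) (hδ.const_mul _), integral_const_mul, integral_const_mul]
        exact hlc)
    unfold conj
    refine le_trans ?_ (le_iSup₂ (f := fun u (_ : u ∈ 𝓤) =>
      (((pairing P u y : ℝ) : EReal) - valueFnInf P f ℱ u)) u hu)
    have hv : valueFnInf P f ℱ u < ((c + pairing P u y : ℝ) : EReal) :=
      lt_of_le_of_lt (iInf₂_le _ hxlI) hfin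
    generalize valueFnInf P f ℱ u = v at hv
    induction v with
    | bot => simp
    | top => simp at hv
    | coe v => norm_cast at hv ⊢; linarith
end

section
/- Fix y ∈ 𝓨. If there exists v ∈ 𝓝^⊥ such that φ̃*(y) = Ef*(v,y), then φ̃*(y) = φ*(y) = inf_{v∈𝓝^⊥} Ef*(v,y), the infimum being attained. -/
open MeasureTheory
open scoped ENNReal

lemma aux_pull {Ω : Type} (m0 : MeasurableSpace Ω) [mΩ : MeasurableSpace Ω]
    (P : Measure Ω) [IsProbabilityMeasure P] (hm : m0 ≤ mΩ) (z g : Ω → ℝ) (hz : Measurable[m0] z)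
    (c : ℝ) (hc : ∀ ω, ‖z ω‖ ≤ c) (hg : Integrable g P) :
    ∫ ω, z ω * g ω ∂P = ∫ ω, z ω * (P[g | m0]) ω ∂P := by
  have h := condExp_stronglyMeasurable_mul_of_bound (μ := P) hm hz.stronglyMeasurable hg c
    (Filter.Eventually.of_forall hc)
  have h2 := integral_condExp (μ := P) (f := z * g) hm
  calc ∫ ω, z ω * g ω ∂P = ∫ ω, (P[z * g | m0]) ω ∂P := h2.symm
    _ = _ := integral_congr_ae h

lemma key_lemma {Ω ι : Type} [mΩ : MeasurableSpace Ω] (P : Measure Ω) [IsProbabilityMeasure P]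
    {L : Type} [LinearOrder L] (𝒢 : L → MeasurableSpace Ω) (hle : ∀ t, 𝒢 t ≤ mΩ)
    (hmono : Monotone 𝒢) (lev : ι → L) (x : ι → Ω → ℝ)
    (hx : ∀ i, Measurable[𝒢 (lev i)] (x i)) (s : Finset ι) :
    ∀ v : ι → Ω → ℝ, (∀ i, Integrable (v i) P) →
      (∀ i ∈ s, P[v i | 𝒢 (lev i)] =ᵐ[P] 0) →
      Integrable (fun ω => max (∑ i ∈ s, x i ω * v i ω) 0) P →
      Integrable (fun ω => ∑ i ∈ s, x i ω * v i ω) P ∧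
        ∫ ω, ∑ i ∈ s, x i ω * v i ω ∂P = 0 := by
  classical
  induction s using Finset.induction_on_max_value lev with
  | empty => intro v _ _ _; simp
  | insert a s ha hmax ih =>
    intro v hv hv0 hpos
    have hm : 𝒢 (lev a) ≤ mΩ := hle _
    set S : Ω → ℝ := fun ω => ∑ i ∈ insert a s, x i ω * v i ω with hS
    set w : ι → Ω → ℝ := fun i => P[v i | 𝒢 (lev a)] with hw
    set R : Ω → ℝ := fun ω => ∑ i ∈ s, x i ω * w i ω with hR
    have hxm : ∀ i ∈ insert a s, Measurable[𝒢 (lev a)] (x i) := by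
      intro i hi
      rcases Finset.mem_insert.1 hi with rfl | hi
      · exact hx _
      · exact (hx i).mono (hmono (hmax i hi)) le_rfl
    have hwm : ∀ i, Measurable[𝒢 (lev a)] (w i) := fun i => stronglyMeasurable_condExp.measurable
    have hwi : ∀ i, Integrable (w i) P := fun i => integrable_condExp
    have hRm : Measurable[𝒢 (lev a)] R := by
      refine Finset.measurable_sum s fun i hi => ?_
      exact (hxm i (Finset.mem_insert_of_mem hi)).mul (hwm i)
    set N : Ω → ℝ := fun ω => ∑ i ∈ insert a s, |x i ω| with hN
    have hNm : Measurable[𝒢 (lev a)] N := by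
      refine Finset.measurable_sum _ fun i hi => ?_
      exact measurable_norm.comp (hxm i hi)
    set A : ℕ → Set Ω := fun k => {ω | N ω ≤ k} with hA
    have hAm : ∀ k, MeasurableSet[𝒢 (lev a)] (A k) := fun k => hNm measurableSet_Iic
    have hcov : AECover P Filter.atTop A := by
      refine ⟨Filter.Eventually.of_forall fun ω => ?_, fun k => hm _ (hAm k)⟩
      obtain ⟨k, hk⟩ := exists_nat_ge (N ω)
      filter_upwards [Filter.eventually_ge_atTop k] with j hj
      exact hk.trans (by exact_mod_cast hj)
    -- bounded coefficients
    have hbd : ∀ k, ∀ C ⊆ A k, ∀ i ∈ insert a s, ∀ ω, ‖C.indicator (x i) ω‖ ≤ (k : ℝ) := by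
      intro k C hC i hi ω
      by_cases h : ω ∈ C
      · rw [Set.indicator_of_mem h, Real.norm_eq_abs]
        have : N ω ≤ k := hC h
        refine le_trans ?_ this
        exact Finset.single_le_sum (f := fun i => |x i ω|) (fun _ _ => abs_nonneg _) hi
      · rw [Set.indicator_of_notMem h]; simp
    have hint : ∀ k, ∀ C ⊆ A k, MeasurableSet[𝒢 (lev a)] C → ∀ g : Ω → ℝ, Integrable g P →
        ∀ i ∈ insert a s, Integrable (fun ω => C.indicator (x i) ω * g ω) P := by
      intro k C hC hCm g hg i hi
      refine hg.bdd_mul (c := k) ?_ (Filter.Eventually.of_forall (hbd k C hC i hi))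
      exact (((hxm i hi).indicator hCm).mono hm le_rfl).aestronglyMeasurable
    have hSC : ∀ C : Set Ω, C.indicator S =
        fun ω => ∑ i ∈ insert a s, C.indicator (x i) ω * v i ω := by
      intro C; ext ω
      by_cases h : ω ∈ C <;> simp [h, hS]
    have hRC : ∀ C : Set Ω, C.indicator R =
        fun ω => ∑ i ∈ s, C.indicator (x i) ω * w i ω := by
      intro C; ext ω
      by_cases h : ω ∈ C <;> simp [h, hR]
    have hSint : ∀ k, ∀ C ⊆ A k, MeasurableSet[𝒢 (lev a)] C → IntegrableOn S C P := by
      intro k C hC hCm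
      rw [← integrable_indicator_iff (hm _ hCm), hSC]
      exact integrable_finsetSum _ fun i hi => hint k C hC hCm _ (hv i) i hi
    have hRint : ∀ k, ∀ C ⊆ A k, MeasurableSet[𝒢 (lev a)] C → IntegrableOn R C P := by
      intro k C hC hCm
      rw [← integrable_indicator_iff (hm _ hCm), hRC]
      exact integrable_finsetSum _ fun i hi =>
        hint k C hC hCm _ (hwi i) i (Finset.mem_insert_of_mem hi)
    have hwa : w a =ᵐ[P] 0 := hv0 a (Finset.mem_insert_self _ _)
    have heq : ∀ k, ∀ C ⊆ A k, MeasurableSet[𝒢 (lev a)] C →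
        ∫ ω in C, S ω ∂P = ∫ ω in C, R ω ∂P := by
      intro k C hC hCm
      rw [← integral_indicator (hm _ hCm), ← integral_indicator (hm _ hCm), hSC, hRC,
        integral_finsetSum _ fun i hi => hint k C hC hCm _ (hv i) i hi,
        integral_finsetSum _ fun i hi =>
          hint k C hC hCm _ (hwi i) i (Finset.mem_insert_of_mem hi)]
      have h1 : ∀ i ∈ insert a s, ∫ ω, C.indicator (x i) ω * v i ω ∂P =
          ∫ ω, C.indicator (x i) ω * w i ω ∂P := fun i hi =>
        aux_pull (𝒢 (lev a)) P hm _ _ ((hxm i hi).indicator hCm) k (hbd k C hC i hi) (hv i)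
      rw [Finset.sum_congr rfl h1, Finset.sum_insert ha]
      have h2 : ∫ ω, C.indicator (x a) ω * w a ω ∂P = 0 := by
        refine integral_eq_zero_of_ae ?_
        filter_upwards [hwa] with ω hω
        simp [hω]
      rw [h2, zero_add]
    have hposR : Integrable (fun ω => max (R ω) 0) P := by
      refine hcov.integrable_of_integral_norm_bounded (∫ ω, max (S ω) 0 ∂P) ?_ ?_
      · intro k
        exact (hRint k (A k) le_rfl (hAm k)).pos_part
      · refine Filter.Eventually.of_forall fun k => ?_
        have hBm : MeasurableSet[𝒢 (lev a)] {ω | 0 ≤ R ω} := hRm measurableSet_Ici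
        have e1 : ∫ ω in A k, ‖max (R ω) 0‖ ∂P = ∫ ω in A k ∩ {ω | 0 ≤ R ω}, R ω ∂P := by
          rw [← setIntegral_indicator (hm _ hBm)]
          congr 1; ext ω
          by_cases h : 0 ≤ R ω
          · simp [Set.indicator, h, abs_of_nonneg]
          · simp [Set.indicator, h, le_of_not_ge h]
        have hCm : MeasurableSet[𝒢 (lev a)] (A k ∩ {ω | 0 ≤ R ω}) :=
          MeasurableSet.inter (hAm k) hBm
        rw [e1, ← heq k _ Set.inter_subset_left hCm]
        calc _ ≤ ∫ ω in A k ∩ {ω | 0 ≤ R ω}, max (S ω) 0 ∂P :=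
              integral_mono (hSint k _ Set.inter_subset_left hCm) hpos.integrableOn
                fun ω => le_max_left _ _
          _ ≤ _ := setIntegral_le_integral hpos
                (Filter.Eventually.of_forall fun ω => le_max_right _ _)
    obtain ⟨hRi, hR0⟩ := ih w hwi (fun i hi =>
      (condExp_condExp_of_le (hmono (hmax i hi)) hm).trans
        (hv0 i (Finset.mem_insert_of_mem hi))) hposR
    have hSi : Integrable S P := by
      refine hcov.integrable_of_integral_norm_bounded
        (2 * ∫ ω, max (S ω) 0 ∂P + ∫ ω, |R ω| ∂P) (fun k => hSint k _ le_rfl (hAm k)) ?_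
      refine Filter.Eventually.of_forall fun k => ?_
      have e1 : ∫ ω in A k, ‖S ω‖ ∂P =
          2 * ∫ ω in A k, max (S ω) 0 ∂P - ∫ ω in A k, S ω ∂P := by
        rw [← integral_const_mul, ← integral_sub (hpos.integrableOn.const_mul 2)
          (hSint k _ le_rfl (hAm k))]
        congr 1; ext ω
        rw [Real.norm_eq_abs]
        rcases le_total 0 (S ω) with h | h
        · rw [abs_of_nonneg h, max_eq_left h]; ring
        · rw [abs_of_nonpos h, max_eq_right h]; ring
      have e2 : ∫ ω in A k, max (S ω) 0 ∂P ≤ ∫ ω, max (S ω) 0 ∂P :=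
        setIntegral_le_integral hpos (Filter.Eventually.of_forall fun ω => le_max_right _ _)
      have e3 : |∫ ω in A k, R ω ∂P| ≤ ∫ ω, |R ω| ∂P :=
        (abs_integral_le_integral_abs).trans
          (setIntegral_le_integral hRi.abs (Filter.Eventually.of_forall fun ω => abs_nonneg _))
      rw [e1, heq k _ le_rfl (hAm k)]
      linarith [neg_abs_le (∫ ω in A k, R ω ∂P)]
    refine ⟨hSi, ?_⟩
    have t1 := hcov.integral_tendsto_of_countably_generated hSi
    have t2 := hcov.integral_tendsto_of_countably_generated hRi
    rw [hR0] at t2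
    refine tendsto_nhds_unique t1 (t2.congr fun k => ?_)
    exact (heq k _ le_rfl (hAm k)).symm

lemma dot_zero {Ω : Type} [mΩ : MeasurableSpace Ω] (P : Measure Ω) [IsProbabilityMeasure P]
    {T : ℕ} (ℱ : Fin (T+1) → MeasurableSpace Ω)
    (hℱ_le : ∀ t, ℱ t ≤ mΩ) (hℱ_mono : Monotone ℱ)
    (nt : Fin (T+1) → ℕ) (x v : Ω → Vec nt) (hx : x ∈ Nspace nt ℱ) (hv : v ∈ Nperp nt ℱ P)
    (hpos : Integrable (fun ω => max (dotN nt (x ω) (v ω)) 0) P) :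
    Integrable (fun ω => dotN nt (x ω) (v ω)) P ∧ ∫ ω, dotN nt (x ω) (v ω) ∂P = 0 := by
  obtain ⟨hvm, hvi, hv0⟩ := hv
  have hvi' : ∀ t i, Integrable (fun ω => v ω t i) P := fun t i =>
    (Integrable.eval (Integrable.eval hvi t) i)
  have hdot : ∀ ω, dotN nt (x ω) (v ω) =
      ∑ p ∈ (Finset.univ : Finset (Σ t, Fin (nt t))), x ω p.1 p.2 * v ω p.1 p.2 := by
    intro ω
    rw [Fintype.sum_sigma]; rfl
  simp only [hdot] at hpos ⊢
  refine key_lemma P ℱ hℱ_le hℱ_mono (fun p : (Σ t, Fin (nt t)) => p.1)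
    (fun p ω => x ω p.1 p.2) ?_ Finset.univ (fun p ω => v ω p.1 p.2) ?_ ?_ hpos
  · intro p
    exact (measurable_pi_apply p.2).comp (hx p.1)
  · intro p; exact hvi' _ _
  · rintro ⟨t, i⟩ -
    refine (ae_eq_condExp_of_forall_setIntegral_eq (hℱ_le t) (hvi' t i) (fun _ _ _ => ?_) ?_
      ?_).symm
    · exact (integrable_zero Ω ℝ P).integrableOn
    · intro A hA _
      classical
      let z : Ω → Vec nt := fun ω => Pi.single t (Pi.single i (A.indicator (fun _ => (1:ℝ)) ω))
      have hz : z ∈ NspaceInf nt ℱ P := by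
        refine ⟨?_, 1, Filter.Eventually.of_forall fun ω => ?_⟩
        · intro t'
          by_cases h : t' = t
          · subst h
            simp only [z, Pi.single_eq_same]
            refine (@measurable_pi_iff Ω _ _ (ℱ t') _ _).2 fun j => ?_
            by_cases hj : j = i
            · subst hj
              simp only [Pi.single_eq_same]
              exact measurable_const.indicator hA
            · simp only [Pi.single_eq_of_ne hj]
              exact measurable_const
          · simp only [z, Pi.single_eq_of_ne h]
            exact measurable_const
        · rw [pi_norm_le_iff_of_nonneg zero_le_one]
          intro t'
          rw [pi_norm_le_iff_of_nonneg zero_le_one]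
          intro j
          by_cases h : t' = t
          · subst h
            simp only [z, Pi.single_eq_same]
            by_cases hj : j = i
            · subst hj
              simp only [Pi.single_eq_same]
              by_cases hω : ω ∈ A <;> simp [hω]
            · simp [Pi.single_eq_of_ne hj]
          · simp [z, Pi.single_eq_of_ne h]
      have h := hv0 z hz
      have hz2 : (fun ω => dotN nt (z ω) (v ω)) = A.indicator (fun ω => v ω t i) := by
        ext ω
        unfold dotN
        rw [Finset.sum_eq_single t, Finset.sum_eq_single i]
        · by_cases hω : ω ∈ A <;> simp [z, hω]
        · intro j _ hj; simp [z, Pi.single_eq_of_ne hj]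
        · simp
        · intro t' _ h'; simp [z, Pi.single_eq_of_ne h']
        · simp
      rw [hz2, integral_indicator (hℱ_le t _ hA)] at h
      simp [h]
    · exact aestronglyMeasurable_zero

lemma epos_mono {a b : EReal} (h : a ≤ b) : epos a ≤ epos b := by
  unfold epos
  by_cases hb : b = ⊤
  · simp [hb]
  have ha : a ≠ ⊤ := fun h' => hb (top_le_iff.1 (h' ▸ h))
  rw [if_neg ha, if_neg hb]
  by_cases ha' : a = ⊥
  · simp [ha']
  exact ENNReal.ofReal_le_ofReal (EReal.toReal_le_toReal h ha' hb)

lemma EE_mono {Ω : Type} [MeasurableSpace Ω] (P : Measure Ω) {g h : Ω → EReal}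
    (hgh : ∀ᵐ ω ∂P, g ω ≤ h ω) : EE P g ≤ EE P h := by
  have h1 : ∫⁻ ω, epos (g ω) ∂P ≤ ∫⁻ ω, epos (h ω) ∂P :=
    lintegral_mono_ae (hgh.mono fun ω hω => epos_mono hω)
  have h2 : ∫⁻ ω, epos (-(h ω)) ∂P ≤ ∫⁻ ω, epos (-(g ω)) ∂P :=
    lintegral_mono_ae (hgh.mono fun ω hω => epos_mono (EReal.neg_le_neg_iff.2 hω))
  unfold EE
  by_cases hh : ∫⁻ ω, epos (h ω) ∂P = ⊤
  · simp [hh]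
  rw [if_neg hh, if_neg (ne_top_of_le_ne_top hh h1)]
  exact EReal.sub_le_sub (by exact_mod_cast h1) (by exact_mod_cast h2)

lemma EE_coe {Ω : Type} [MeasurableSpace Ω] (P : Measure Ω) {F : Ω → ℝ}
    (hF : Integrable F P) : EE P (fun ω => ((F ω : ℝ) : EReal)) = ((∫ ω, F ω ∂P : ℝ) : EReal) := by
  have e1 : ∀ r : ℝ, epos (r : EReal) = ENNReal.ofReal r := by
    intro r; simp [epos]
  have e2 : ∀ r : ℝ, epos (-(r : EReal)) = ENNReal.ofReal (-r) := by
    intro r; rw [← EReal.coe_neg, e1]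
  have h1 : ∫⁻ ω, ENNReal.ofReal (F ω) ∂P ≠ ⊤ := hF.lintegral_lt_top.ne
  have h2 : ∫⁻ ω, ENNReal.ofReal (-F ω) ∂P ≠ ⊤ := hF.neg.lintegral_lt_top.ne
  unfold EE
  simp only [e1, e2]
  rw [if_neg h1, integral_eq_lintegral_pos_part_sub_lintegral_neg_part hF, EReal.coe_sub,
    EReal.coe_ennreal_toReal h1, EReal.coe_ennreal_toReal h2]

lemma EE_lt_top {Ω : Type} [MeasurableSpace Ω] (P : Measure Ω) {g : Ω → EReal}
    (h : EE P g ≠ ⊤) : ∫⁻ ω, epos (g ω) ∂P ≠ ⊤ := by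
  intro h'; exact h (by simp [EE, h'])

lemma epos_measurable : Measurable epos := by
  unfold epos
  exact Measurable.ite (measurableSet_singleton _) measurable_const
    measurable_ereal_toReal.ennreal_ofReal

lemma ereal_swap (a : ℝ) (b c : EReal) (h : (a : EReal) - b ≤ c) : (a : EReal) - c ≤ b := by
  induction b with
  | bot =>
    have : c = ⊤ := by simpa using h
    simp [this]
  | top => exact le_top
  | coe b =>
    induction c with
    | bot => rw [← EReal.coe_sub] at h; exact absurd (le_bot_iff.1 h) (EReal.coe_ne_bot _)
    | top => simp
    | coe c =>
      rw [← EReal.coe_sub, EReal.coe_le_coe_iff] at *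
      linarith

lemma weak_duality
    {Ω : Type} [mΩ : MeasurableSpace Ω] (P : Measure Ω) [IsProbabilityMeasure P]
    {T : ℕ} (ℱ : Fin (T+1) → MeasurableSpace Ω)
    (hℱ_le : ∀ t, ℱ t ≤ mΩ) (hℱ_mono : Monotone ℱ)
    (nt : Fin (T+1) → ℕ) {m : ℕ}
    (f : Vec nt → (Fin m → ℝ) → Ω → EReal)
    (hf_meas : Measurable (fun p : (Vec nt × (Fin m → ℝ)) × Ω => f p.1.1 p.1.2 p.2))
    (hf_proper : ∀ ω, (∀ x u, f x u ω ≠ ⊥))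
    (x v : Ω → Vec nt) (u y : Ω → Fin m → ℝ) (hum : Measurable u)
    (huy : Integrable (fun ω => dotM (u ω) (y ω)) P)
    (hx : x ∈ Nspace nt ℱ) (hv : v ∈ Nperp nt ℱ P) :
    ((pairing P u y : ℝ) : EReal) - intF P f x u ≤ intFconj P f v y := by
  by_cases hF : intF P f x u = ⊤
  · simp [hF]
  by_cases hH : intFconj P f v y = ⊤
  · simp [hH]
  have hxm : Measurable x := measurable_pi_iff.2 fun t => (hx t).mono (hℱ_le t) le_rfl
  have hgm : Measurable (fun ω => f (x ω) (u ω) ω) :=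
    hf_meas.comp ((hxm.prodMk hum).prodMk measurable_id)
  have h1 := EE_lt_top P hF
  have h2 := EE_lt_top P hH
  have hae : ∀ᵐ ω ∂P, f (x ω) (u ω) ω ≠ ⊤ := by
    filter_upwards [ae_lt_top (epos_measurable.comp hgm) h1] with ω hω h
    simp [h, epos] at hω
  set F : Ω → ℝ := fun ω => (f (x ω) (u ω) ω).toReal with hFdef
  have hFm : Measurable F := measurable_ereal_toReal.comp hgm
  have hFe : ∀ᵐ ω ∂P, f (x ω) (u ω) ω = (F ω : EReal) := by
    filter_upwards [hae] with ω hω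
    exact (EReal.coe_toReal hω (hf_proper ω _ _)).symm
  set X : Ω → ℝ := fun ω => dotN nt (x ω) (v ω) with hX
  set Y : Ω → ℝ := fun ω => dotM (u ω) (y ω) with hY
  have hXm : Measurable X := by
    refine Finset.measurable_sum _ fun t _ => Finset.measurable_sum _ fun i _ => ?_
    have := hv.1
    fun_prop
  set G : Ω → ℝ := fun ω => X ω + Y ω - F ω with hG
  have hGm : AEStronglyMeasurable G P :=
    (hXm.aestronglyMeasurable.add huy.1).sub hFm.aestronglyMeasurable
  have hGh : ∀ᵐ ω ∂P, (G ω : EReal) ≤ fconj f (v ω) (y ω) ω := by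
    filter_upwards [hFe] with ω hω
    have : (((X ω + Y ω : ℝ) : EReal) - f (x ω) (u ω) ω) ≤ fconj f (v ω) (y ω) ω :=
      le_iSup₂_of_le (x ω) (u ω) le_rfl
    rw [hω, ← EReal.coe_sub] at this
    exact this
  have hpp : ∀ K : Ω → ℝ, AEStronglyMeasurable K P → ∀ g : Ω → EReal,
      (∀ᵐ ω ∂P, (K ω : EReal) ≤ g ω) → ∫⁻ ω, epos (g ω) ∂P ≠ ⊤ →
      Integrable (fun ω => max (K ω) 0) P := by
    intro K hK g hKg hg
    refine (lintegral_ofReal_ne_top_iff_integrable (hK.sup aestronglyMeasurable_const)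
      (Filter.Eventually.of_forall fun ω => le_max_right _ _)).1 ?_
    refine ne_top_of_le_ne_top hg (lintegral_mono_ae ?_)
    filter_upwards [hKg] with ω hω
    have := epos_mono hω
    have e : ENNReal.ofReal (max (K ω) 0) = epos (K ω : EReal) := by simp [epos]
    exact e.trans_le this
  have hFp := hpp F hFm.aestronglyMeasurable _ (hFe.mono fun ω h => h.ge) h1
  have hGp := hpp G hGm _ hGh h2
  have hXp : Integrable (fun ω => max (X ω) 0) P := by
    refine ((hFp.add hGp).add huy.abs).mono' (hXm.max measurable_const).aestronglyMeasurable
      (Filter.Eventually.of_forall fun ω => ?_)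
    simp only [Pi.add_apply]
    rw [Real.norm_of_nonneg (le_max_right _ _)]
    have a1 := le_max_left (F ω) 0
    have a2 := le_max_left (G ω) 0
    have a1' := le_max_right (F ω) 0
    have a2' := le_max_right (G ω) 0
    have a3 := neg_abs_le (Y ω)
    have a4 := abs_nonneg (Y ω)
    have a5 : G ω = X ω + Y ω - F ω := rfl
    refine max_le ?_ ?_
    · change X ω ≤ max (F ω) 0 + max (G ω) 0 + |Y ω|
      linarith
    · change 0 ≤ max (F ω) 0 + max (G ω) 0 + |Y ω|
      linarith
  obtain ⟨hXi, hX0⟩ := dot_zero P ℱ hℱ_le hℱ_mono nt x v hx hv hXp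
  have hFi : Integrable F P := by
    refine (((hFp.add hGp).add huy.abs).add hXi.abs).mono' hFm.aestronglyMeasurable
      (Filter.Eventually.of_forall fun ω => ?_)
    change |F ω| ≤ max (F ω) 0 + max (G ω) 0 + |Y ω| + |X ω|
    have a1 := le_max_left (F ω) 0
    have a2 := le_max_left (G ω) 0
    have a1' := le_max_right (F ω) 0
    have a2' := le_max_right (G ω) 0
    have a3 := neg_abs_le (Y ω)
    have a4 := abs_nonneg (Y ω)
    have a6 := neg_abs_le (X ω)
    have a7 := abs_nonneg (X ω)
    have a5 : G ω = X ω + Y ω - F ω := rfl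
    exact abs_le.2 ⟨by linarith, by linarith⟩
  have hGi : Integrable G P := (hXi.add huy).sub hFi
  have e1 : ((∫ ω, F ω ∂P : ℝ) : EReal) ≤ intF P f x u := by
    rw [← EE_coe P hFi]
    exact EE_mono P (hFe.mono fun ω h => h.ge)
  have e2 : ((∫ ω, G ω ∂P : ℝ) : EReal) ≤ intFconj P f v y := by
    rw [← EE_coe P hGi]
    exact EE_mono P hGh
  have e3 : ∫ ω, G ω ∂P = pairing P u y - ∫ ω, F ω ∂P := by
    have q1 : ∫ ω, G ω ∂P = ∫ ω, (X ω + Y ω) ∂P - ∫ ω, F ω ∂P :=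
      integral_sub (hXi.add huy) hFi
    have q2 : ∫ ω, (X ω + Y ω) ∂P = ∫ ω, X ω ∂P + ∫ ω, Y ω ∂P := integral_add hXi huy
    rw [q1, q2, hX0, zero_add]; rfl
  refine le_trans (EReal.sub_le_sub le_rfl e1) ?_
  rw [← EReal.coe_sub, ← e3]
  exact e2

/-- if `φ̃*(y) = Ef*(v,y)` for some `v ∈ 𝓝^⊥`, then
`φ̃*(y) = φ*(y) = min_{v∈𝓝^⊥} Ef*(v,y)`, the infimum being attained. -/
theorem stmt_4
    {Ω : Type} [mΩ : MeasurableSpace Ω] (P : Measure Ω) [IsProbabilityMeasure P]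
    {T : ℕ} (ℱ : Fin (T+1) → MeasurableSpace Ω)
    (hℱ_le : ∀ t, ℱ t ≤ mΩ) (hℱ_mono : Monotone ℱ)
    (nt : Fin (T+1) → ℕ) {m : ℕ}
    -- `f` is a convex normal integrand
    (f : Vec nt → (Fin m → ℝ) → Ω → EReal)
    (hf_meas : Measurable (fun p : (Vec nt × (Fin m → ℝ)) × Ω => f p.1.1 p.1.2 p.2))
    (hf_proper : ∀ ω, (∀ x u, f x u ω ≠ ⊥) ∧ ∃ x u, f x u ω ≠ ⊤)
    (hf_lsc : ∀ ω, LowerSemicontinuous (fun p : Vec nt × (Fin m → ℝ) => f p.1 p.2 ω))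
    (hf_convex : ∀ (ω : Ω) (a b : ℝ) (x₁ x₂ : Vec nt) (u₁ u₂ : Fin m → ℝ),
      0 < a → 0 < b → a + b = 1 →
      f (a • x₁ + b • x₂) (a • u₁ + b • u₂) ω ≤
        (a : EReal) * f x₁ u₁ ω + (b : EReal) * f x₂ u₂ ω)
    -- `𝓤` and `𝓨` are decomposable subspaces of `L⁰` in separating duality
    (𝓤 𝓨 : Set (Ω → Fin m → ℝ))
    (h𝓤meas : ∀ u ∈ 𝓤, Measurable u) (h𝓨meas : ∀ y ∈ 𝓨, Measurable y)
    (h𝓤sub : ∀ u ∈ 𝓤, ∀ u' ∈ 𝓤, ∀ c : ℝ, u + u' ∈ 𝓤 ∧ c • u ∈ 𝓤)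
    (h𝓨sub : ∀ y ∈ 𝓨, ∀ y' ∈ 𝓨, ∀ c : ℝ, y + y' ∈ 𝓨 ∧ c • y ∈ 𝓨)
    (h𝓤dec : Decomposable P 𝓤) (h𝓨dec : Decomposable P 𝓨)
    (hpair : ∀ u ∈ 𝓤, ∀ y ∈ 𝓨, Integrable (fun ω => dotM (u ω) (y ω)) P)
    (hsep𝓤 : ∀ u ∈ 𝓤, (∀ y ∈ 𝓨, pairing P u y = 0) → u =ᵐ[P] (fun _ => 0))
    (hsep𝓨 : ∀ y ∈ 𝓨, (∀ u ∈ 𝓤, pairing P u y = 0) → y =ᵐ[P] (fun _ => 0))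
    (y : Ω → Fin m → ℝ) (hy : y ∈ 𝓨)
    (hex : ∃ v ∈ Nperp nt ℱ P, conj P 𝓤 (valueFnInf P f ℱ) y = intFconj P f v y) :
    conj P 𝓤 (valueFnInf P f ℱ) y = conj P 𝓤 (valueFn P f ℱ) y ∧
    conj P 𝓤 (valueFn P f ℱ) y = ⨅ v ∈ Nperp nt ℱ P, intFconj P f v y ∧
    ∃ v ∈ Nperp nt ℱ P, intFconj P f v y = ⨅ w ∈ Nperp nt ℱ P, intFconj P f w y := by
  have hweak : ∀ v ∈ Nperp nt ℱ P, conj P 𝓤 (valueFn P f ℱ) y ≤ intFconj P f v y := by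
    intro v hv
    refine iSup₂_le fun u hu => ?_
    refine ereal_swap _ _ _ (le_iInf₂ fun x hx => ?_)
    refine ereal_swap _ _ _ ?_
    exact weak_duality P ℱ hℱ_le hℱ_mono nt f hf_meas (fun ω => (hf_proper ω).1) x v u y
      (h𝓤meas u hu) (hpair u hu y hy) hx hv
  have hle : conj P 𝓤 (valueFnInf P f ℱ) y ≤ conj P 𝓤 (valueFn P f ℱ) y := by
    refine iSup₂_mono fun u hu => EReal.sub_le_sub le_rfl ?_
    exact le_iInf₂ fun x hx => iInf₂_le x hx.1
  obtain ⟨v, hv, hveq⟩ := hex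
  have h1 : conj P 𝓤 (valueFn P f ℱ) y ≤ ⨅ v ∈ Nperp nt ℱ P, intFconj P f v y :=
    le_iInf₂ hweak
  have h2 : (⨅ v ∈ Nperp nt ℱ P, intFconj P f v y) ≤ intFconj P f v y := iInf₂_le v hv
  have h3 := hle.trans h1
  refine ⟨le_antisymm hle (hveq ▸ hweak v hv), le_antisymm h1 ?_, v, hv, le_antisymm ?_ h2⟩
  · exact h2.trans (hveq ▸ hle)
  · exact hveq ▸ h3
end
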